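/- Let k = 1. Let I = (a,b) with 0 < a < b and let I' = (a−Δ, b−Δ') with Δ > 0, Δ' ≥ 0, a−Δ < b−Δ', and μ(I') = μ(I). Then for every r ∈ [0, a−Δ] one has T 1_{I'}(r) ≥ T 1_I(r); explicitly, √((b−Δ')² − r²) − √((a−Δ)² − r²) ≥ √(b² − r²) − √(a² − r²). -/

import Mathlib

open MeasureTheory Set Filter Topology

noncomputable section

/-- The measure `r^(d-1) dr` on `(0, ∞)`. -/
def mu (d : ℕ) : Measure ℝ :=
  (volume.restrict (Ioi (0:ℝ))).withDensity (fun r => ENNReal.ofReal (r ^ (d - 1)))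

/-- The measure `r^(d-k-1) dr` on `(0, ∞)`. -/
def nu (d k : ℕ) : Measure ℝ :=
  (volume.restrict (Ioi (0:ℝ))).withDensity (fun r => ENNReal.ofReal (r ^ (d - k - 1)))

/-- The one-dimensional model operator for the k-plane transform on radial functions. -/
def T (k : ℕ) (f : ℝ → ℝ) (r : ℝ) : ℝ :=
  ∫ u in Ioi r, f u * (u ^ 2 - r ^ 2) ^ ((k : ℝ) / 2 - 1) * u

/-- `p = (d+1)/(k+1)`. -/
def pExp (d k : ℕ) : ℝ := ((d : ℝ) + 1) / ((k : ℝ) + 1)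

/-- `q = d+1`. -/
def qExp (d : ℕ) : ℝ := (d : ℝ) + 1

/-- `B` is the best constant in the `L^p(μ) → L^q(ν)` inequality for `T`. -/
def IsBestConstant (d k : ℕ) (B : ℝ) : Prop :=
  IsLeast {C : ℝ | 0 ≤ C ∧ ∀ f : ℝ → ℝ, Measurable f → (∀ r, 0 ≤ f r) →
    eLpNorm (T k f) (ENNReal.ofReal (qExp d)) (nu d k) ≤
      ENNReal.ofReal C * eLpNorm f (ENNReal.ofReal (pExp d k)) (mu d)} B

/-- `(f n)` is an extremizing sequence for the inequality. -/
def Extremizing (d k : ℕ) (B : ℝ) (f : ℕ → ℝ → ℝ) : Prop :=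
  (∀ n, Measurable (f n)) ∧ (∀ n r, 0 ≤ f n r) ∧
  (∀ n, eLpNorm (f n) (ENNReal.ofReal (pExp d k)) (mu d) = 1) ∧
  Tendsto (fun n => (eLpNorm (T k (f n)) (ENNReal.ofReal (qExp d)) (nu d k)).toReal)
    atTop (𝓝 B)

lemma mu_Ioo (d : ℕ) (hd : 1 ≤ d) {c e : ℝ} (hc : 0 ≤ c) (hce : c ≤ e) :
    mu d (Ioo c e) = ENNReal.ofReal ((e ^ d - c ^ d) / d) := by
  obtain ⟨n, rfl⟩ : ∃ n, d = n + 1 := ⟨d - 1, by omega⟩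
  have hsub : Ioo c e ∩ Ioi 0 = Ioo c e :=
    inter_eq_left.mpr fun x hx => hc.trans_lt hx.1
  have hint : IntegrableOn (fun x : ℝ => x ^ n) (Ioo c e) volume :=
    ((continuous_pow n).continuousOn.integrableOn_compact isCompact_Icc).mono_set
      Ioo_subset_Icc_self
  have hnonneg : 0 ≤ᵐ[volume.restrict (Ioo c e)] fun x : ℝ => x ^ n :=
    (ae_restrict_mem measurableSet_Ioo).mono fun x hx => pow_nonneg (hc.trans hx.1.le) n
  rw [mu, withDensity_apply _ measurableSet_Ioo, Measure.restrict_restrict measurableSet_Ioo,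
    hsub, Nat.add_sub_cancel, ← ofReal_integral_eq_lintegral_ofReal hint hnonneg,
    ← integral_Ioc_eq_integral_Ioo, ← intervalIntegral.integral_of_le hce, integral_pow]
  push_cast
  rfl

lemma T_one_indicator_Ioo {c e r : ℝ} (hr : 0 ≤ r) (hrc : r ≤ c) (hce : c ≤ e) :
    T 1 ((Ioo c e).indicator (fun _ => (1 : ℝ))) r =
      Real.sqrt (e ^ 2 - r ^ 2) - Real.sqrt (c ^ 2 - r ^ 2) := by
  have hderiv : ∀ u ∈ Ioo c e, HasDerivAt (fun u : ℝ => Real.sqrt (u ^ 2 - r ^ 2))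
      ((u ^ 2 - r ^ 2) ^ (((1 : ℕ) : ℝ) / 2 - 1) * u) u := by
    intro u hu
    have hpos : 0 < u ^ 2 - r ^ 2 := by nlinarith [hu.1]
    have h := (((hasDerivAt_pow 2 u).sub_const (r ^ 2)).sqrt hpos.ne')
    convert h using 1
    rw [show ((1 : ℕ) : ℝ) / 2 - 1 = -(1 / 2) by norm_num, Real.rpow_neg hpos.le,
      ← Real.sqrt_eq_rpow]
    field_simp
    norm_num
    ring
  have hcont : ContinuousOn (fun u : ℝ => Real.sqrt (u ^ 2 - r ^ 2)) (Icc c e) := by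
    fun_prop
  have hint : IntervalIntegrable
      (fun u : ℝ => (u ^ 2 - r ^ 2) ^ (((1 : ℕ) : ℝ) / 2 - 1) * u) volume c e := by
    rw [intervalIntegrable_iff_integrableOn_Ioc_of_le hce]
    refine intervalIntegral.integrableOn_deriv_of_nonneg hcont hderiv fun u hu => ?_
    have hpos : 0 ≤ u ^ 2 - r ^ 2 := by nlinarith [hu.1]
    exact mul_nonneg (Real.rpow_nonneg hpos _) (hr.trans (hrc.trans hu.1.le))
  have hind : ∀ u : ℝ, (Ioo c e).indicator (fun _ => (1 : ℝ)) u *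
      (u ^ 2 - r ^ 2) ^ (((1 : ℕ) : ℝ) / 2 - 1) * u =
      (Ioo c e).indicator (fun u => (u ^ 2 - r ^ 2) ^ (((1 : ℕ) : ℝ) / 2 - 1) * u) u := by
    intro u
    by_cases hu : u ∈ Ioo c e <;> simp [hu]
  have hsub : Ioi r ∩ Ioo c e = Ioo c e :=
    inter_eq_right.mpr fun x hx => hrc.trans_lt hx.1
  rw [T]
  simp_rw [hind]
  rw [setIntegral_indicator measurableSet_Ioo, hsub, ← integral_Ioc_eq_integral_Ioo,
    ← intervalIntegral.integral_of_le hce,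
    intervalIntegral.integral_eq_sub_of_hasDerivAt_of_le hce hcont hderiv hint]

lemma convexOn_sqrt_sq_add_sq (r : ℝ) :
    ConvexOn ℝ univ fun x : ℝ => Real.sqrt (x ^ 2 + r ^ 2) := by
  have h := (convexOn_univ_norm (E := ℂ)).comp_affineMap
    (AffineMap.lineMap (r * Complex.I : ℂ) (1 + r * Complex.I) : ℝ →ᵃ[ℝ] ℂ)
  refine h.congr fun x _ => ?_
  simp [AffineMap.lineMap_apply, Complex.norm_add_mul_I]

/-- Increments of a convex function over intervals of equal length increase to the right. -/
lemma ConvexOn.sub_le_sub_of_le {h : ℝ → ℝ} (hh : ConvexOn ℝ univ h) {x y l : ℝ}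
    (hxy : x ≤ y) (hl : 0 ≤ l) : h (x + l) - h x ≤ h (y + l) - h y := by
  rcases hxy.eq_or_lt with rfl | hlt
  · rfl
  have hpos : 0 < y - x + l := by linarith
  have hsum : (y - x) / (y - x + l) + l / (y - x + l) = 1 := by field_simp
  have hs : 0 ≤ (y - x) / (y - x + l) := div_nonneg (by linarith) hpos.le
  have ht : 0 ≤ l / (y - x + l) := div_nonneg hl hpos.le
  have h₁ := hh.2 (mem_univ x) (mem_univ (y + l)) hs ht hsum
  have h₂ := hh.2 (mem_univ x) (mem_univ (y + l)) ht hs (by rw [add_comm, hsum])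
  have e₁ : (y - x) / (y - x + l) * x + l / (y - x + l) * (y + l) = x + l := by
    field_simp; ring
  have e₂ : l / (y - x + l) * x + (y - x) / (y - x + l) * (y + l) = y := by
    field_simp; ring
  simp only [smul_eq_mul, e₁, e₂] at h₁ h₂
  linear_combination h₁ + h₂ + (h x + h (y + l)) * hsum

/-- Moving an interval toward the origin while preserving the increment of `x ^ d` increases
the increment of `√(x ^ 2 - r ^ 2)`. -/
lemma sqrt_sub_sqrt_le_of_pow_sub_pow_eq {d : ℕ} (hd : d ≠ 0) {a b a' b' r : ℝ} (hr : 0 ≤ r)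
    (hra : r ≤ a') (haa : a' ≤ a) (hab' : a' ≤ b') (hab : a ≤ b)
    (hpow : b' ^ d - a' ^ d = b ^ d - a ^ d) :
    Real.sqrt (b ^ 2 - r ^ 2) - Real.sqrt (a ^ 2 - r ^ 2) ≤
      Real.sqrt (b' ^ 2 - r ^ 2) - Real.sqrt (a' ^ 2 - r ^ 2) := by
  let h : ℝ → ℝ := fun x => Real.sqrt (x ^ 2 + r ^ 2) ^ d
  have hconv : ConvexOn ℝ univ h :=
    (convexOn_sqrt_sq_add_sq r).pow (fun _ _ => Real.sqrt_nonneg _) d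
  have hval : ∀ x, r ≤ x → h (Real.sqrt (x ^ 2 - r ^ 2)) = x ^ d := by
    intro x hx
    have hnn : 0 ≤ x ^ 2 - r ^ 2 := by nlinarith
    simp only [h, Real.sq_sqrt hnn, sub_add_cancel, Real.sqrt_sq (hr.trans hx)]
  have hmono : ∀ x y, 0 ≤ x → x < y → h x < h y := fun x y hx hxy =>
    pow_lt_pow_left₀ (Real.sqrt_lt_sqrt (by positivity) (by nlinarith)) (Real.sqrt_nonneg _) hd
  have hsa : Real.sqrt (a' ^ 2 - r ^ 2) ≤ Real.sqrt (a ^ 2 - r ^ 2) :=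
    Real.sqrt_le_sqrt (by nlinarith)
  have hsb : Real.sqrt (a' ^ 2 - r ^ 2) ≤ Real.sqrt (b' ^ 2 - r ^ 2) :=
    Real.sqrt_le_sqrt (by nlinarith)
  have hinc := hconv.sub_le_sub_of_le hsa (sub_nonneg.mpr hsb)
  by_contra! hlt
  have hstrict := hmono (Real.sqrt (a ^ 2 - r ^ 2) +
    (Real.sqrt (b' ^ 2 - r ^ 2) - Real.sqrt (a' ^ 2 - r ^ 2))) (Real.sqrt (b ^ 2 - r ^ 2))
    (add_nonneg (Real.sqrt_nonneg _) (sub_nonneg.mpr hsb)) (by linarith)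
  rw [add_sub_cancel, hval _ (hra.trans hab'), hval _ hra, hval _ (hra.trans haa)] at hinc
  rw [hval _ (hra.trans (haa.trans hab))] at hstrict
  linarith

/-- pointwise comparison of `T 1_{I'}` and `T 1_I` on `[0, a - Δ]`
when the interval `I' = (a-Δ, b-Δ')` is the interval `I = (a,b)` slid toward the
origin preserving its `μ`-measure (case `k = 1`). -/
theorem T_indicator_slide_interval_pointwise
    (d : ℕ) (hd : 2 ≤ d)
    (a b Δ Δ' : ℝ) (ha : 0 < a) (hab : a < b) (hΔ : 0 < Δ) (hΔ' : 0 ≤ Δ')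
    (hI' : a - Δ < b - Δ')
    (hmu : mu d (Ioo (a - Δ) (b - Δ')) = mu d (Ioo a b)) :
    ∀ r ∈ Icc 0 (a - Δ),
      T 1 ((Ioo a b).indicator (fun _ => (1 : ℝ))) r ≤
        T 1 ((Ioo (a - Δ) (b - Δ')).indicator (fun _ => (1 : ℝ))) r ∧
      Real.sqrt (b ^ 2 - r ^ 2) - Real.sqrt (a ^ 2 - r ^ 2) ≤
        Real.sqrt ((b - Δ') ^ 2 - r ^ 2) - Real.sqrt ((a - Δ) ^ 2 - r ^ 2) := by
  intro r hr
  have hd0 : (0 : ℝ) < d := by exact_mod_cast (by omega : 0 < d)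
  have ha' : 0 ≤ a - Δ := hr.1.trans hr.2
  have hpow : (b - Δ') ^ d - (a - Δ) ^ d = b ^ d - a ^ d := by
    have hnn : ∀ c e : ℝ, 0 ≤ c → c < e → 0 ≤ (e ^ d - c ^ d) / d := fun c e hc hce =>
      div_nonneg (sub_nonneg.mpr (pow_le_pow_left₀ hc hce.le d)) hd0.le
    rw [mu_Ioo d (by omega) ha' hI'.le, mu_Ioo d (by omega) ha.le hab.le,
      ENNReal.ofReal_eq_ofReal_iff (hnn _ _ ha' hI') (hnn _ _ ha.le hab)] at hmu
    exact (div_left_inj' hd0.ne').mp hmu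
  have hle := sqrt_sub_sqrt_le_of_pow_sub_pow_eq (by omega) hr.1 hr.2 (by linarith) hI'.le
    hab.le hpow
  rw [T_one_indicator_Ioo hr.1 (by linarith [hr.2]) hab.le, T_one_indicator_Ioo hr.1 hr.2 hI'.le]
  exact ⟨hle, hle⟩
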